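/- Let p ≥ 1 with p ≠ 2, and let U : ℝ → Matrix (Fin 2) (Fin 2) ℝ be a continuous map with U(0) equal to the identity matrix and U(s + t) = U(s) · U(t) for all real s, t, such that for every t the linear map v ↦ U(t).mulVec v satisfies |（U(t).mulVec v) 0|^p + |(U(t).mulVec v) 1|^p = |v 0|^p + |v 1|^p for all v ∈ ℝ². Then U(t) is the identity matrix for all t; that is, there is no nonconstant continuous one-parameter group of linear transformations preserving the p-th-power weight sum when p ≠ 2. -/

import Mathlib

lemma abs_rpow_eq_sq_rpow_half (x p : ℝ) : |x| ^ p = (x ^ 2) ^ (p / 2) := by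
  rw [← sq_abs, ← Real.rpow_natCast_mul (abs_nonneg x)]
  congr 1
  push_cast
  ring

lemma Real.add_rpow_eq_mul_rpow_sub_one_add {x y : ℝ} (hx : 0 < x) (hy : 0 < y) (s : ℝ) :
    (x + y) ^ s = x * (x + y) ^ (s - 1) + y * (x + y) ^ (s - 1) := by
  rw [← add_mul, Real.rpow_sub_one (by positivity)]
  field_simp

lemma Real.mul_rpow_sub_one {x : ℝ} (hx : 0 < x) (s : ℝ) : x * x ^ (s - 1) = x ^ s := by
  rw [Real.rpow_sub_one hx.ne']
  field_simp

lemma Real.add_rpow_lt_rpow_add_rpow {x y s : ℝ} (hx : 0 < x) (hy : 0 < y) (hs : s < 1) :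
    (x + y) ^ s < x ^ s + y ^ s := by
  rw [Real.add_rpow_eq_mul_rpow_sub_one_add hx hy, ← Real.mul_rpow_sub_one hx,
    ← Real.mul_rpow_sub_one hy]
  have h₁ : (x + y) ^ (s - 1) < x ^ (s - 1) :=
    Real.rpow_lt_rpow_of_neg hx (by linarith) (by linarith)
  have h₂ : (x + y) ^ (s - 1) < y ^ (s - 1) :=
    Real.rpow_lt_rpow_of_neg hy (by linarith) (by linarith)
  gcongr

lemma Real.rpow_add_rpow_lt_add_rpow {x y s : ℝ} (hx : 0 < x) (hy : 0 < y) (hs : 1 < s) :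
    x ^ s + y ^ s < (x + y) ^ s := by
  rw [Real.add_rpow_eq_mul_rpow_sub_one_add hx hy, ← Real.mul_rpow_sub_one hx,
    ← Real.mul_rpow_sub_one hy]
  have h₁ : x ^ (s - 1) < (x + y) ^ (s - 1) :=
    Real.rpow_lt_rpow hx.le (by linarith) (by linarith)
  have h₂ : y ^ (s - 1) < (x + y) ^ (s - 1) :=
    Real.rpow_lt_rpow hy.le (by linarith) (by linarith)
  gcongr

/-- The strict scalar Clarkson inequality for exponents below `2`. -/
lemma abs_add_rpow_add_abs_sub_rpow_lt {p u v : ℝ} (hp : 0 < p) (hp2 : p < 2)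
    (hu : u ≠ 0) (hv : v ≠ 0) :
    |u + v| ^ p + |u - v| ^ p < 2 * |u| ^ p + 2 * |v| ^ p := by
  simp only [abs_rpow_eq_sq_rpow_half _ p]
  have h₁ := (Real.concaveOn_rpow (p := p / 2) (by linarith) (by linarith)).2
    (Set.mem_Ici.2 (sq_nonneg (u + v))) (Set.mem_Ici.2 (sq_nonneg (u - v)))
    (by norm_num : (0 : ℝ) ≤ 1 / 2) (by norm_num : (0 : ℝ) ≤ 1 / 2) (by norm_num)
  have h₂ := Real.add_rpow_lt_rpow_add_rpow (s := p / 2) (sq_pos_of_ne_zero hu)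
    (sq_pos_of_ne_zero hv) (by linarith)
  simp only [smul_eq_mul] at h₁
  rw [show 1 / 2 * (u + v) ^ 2 + 1 / 2 * (u - v) ^ 2 = u ^ 2 + v ^ 2 by ring] at h₁
  linarith

/-- The strict scalar Clarkson inequality for exponents above `2`. -/
lemma lt_abs_add_rpow_add_abs_sub_rpow {p u v : ℝ} (hp2 : 2 < p) (hu : u ≠ 0) (hv : v ≠ 0) :
    2 * |u| ^ p + 2 * |v| ^ p < |u + v| ^ p + |u - v| ^ p := by
  simp only [abs_rpow_eq_sq_rpow_half _ p]
  have h₁ := (convexOn_rpow (p := p / 2) (by linarith)).2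
    (Set.mem_Ici.2 (sq_nonneg (u + v))) (Set.mem_Ici.2 (sq_nonneg (u - v)))
    (by norm_num : (0 : ℝ) ≤ 1 / 2) (by norm_num : (0 : ℝ) ≤ 1 / 2) (by norm_num)
  have h₂ := Real.rpow_add_rpow_lt_add_rpow (s := p / 2) (sq_pos_of_ne_zero hu)
    (sq_pos_of_ne_zero hv) (by linarith)
  simp only [smul_eq_mul] at h₁
  rw [show 1 / 2 * (u + v) ^ 2 + 1 / 2 * (u - v) ^ 2 = u ^ 2 + v ^ 2 by ring] at h₁
  linarith

lemma abs_add_rpow_add_abs_sub_rpow_of_mul_eq_zero {p u v : ℝ} (hp : 0 < p) (h : u * v = 0) :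
    |u + v| ^ p + |u - v| ^ p = 2 * |u| ^ p + 2 * |v| ^ p := by
  rcases mul_eq_zero.1 h with rfl | rfl <;> simp [Real.zero_rpow hp.ne'] <;> ring

/-- Equality in the sum of two scalar Clarkson inequalities forces disjoint supports. -/
lemma mul_eq_zero_of_clarkson_eq {p a b c d : ℝ} (hp : 0 < p) (hp2 : p ≠ 2)
    (h : |a + b| ^ p + |a - b| ^ p + (|c + d| ^ p + |c - d| ^ p) =
      2 * |a| ^ p + 2 * |b| ^ p + (2 * |c| ^ p + 2 * |d| ^ p)) :
    a * b = 0 ∧ c * d = 0 := by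
  rcases lt_or_gt_of_ne hp2 with hlt | hgt
  · have key (u v : ℝ) (huv : u * v ≠ 0) :=
      abs_add_rpow_add_abs_sub_rpow_lt hp hlt (left_ne_zero_of_mul huv) (right_ne_zero_of_mul huv)
    by_cases hab : a * b = 0 <;> by_cases hcd : c * d = 0
    · exact ⟨hab, hcd⟩
    · linarith [abs_add_rpow_add_abs_sub_rpow_of_mul_eq_zero hp hab, key c d hcd]
    · linarith [abs_add_rpow_add_abs_sub_rpow_of_mul_eq_zero hp hcd, key a b hab]
    · linarith [key a b hab, key c d hcd]
  · have key (u v : ℝ) (huv : u * v ≠ 0) :=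
      lt_abs_add_rpow_add_abs_sub_rpow hgt (left_ne_zero_of_mul huv) (right_ne_zero_of_mul huv)
    by_cases hab : a * b = 0 <;> by_cases hcd : c * d = 0
    · exact ⟨hab, hcd⟩
    · linarith [abs_add_rpow_add_abs_sub_rpow_of_mul_eq_zero hp hab, key c d hcd]
    · linarith [abs_add_rpow_add_abs_sub_rpow_of_mul_eq_zero hp hcd, key a b hab]
    · linarith [key a b hab, key c d hcd]

lemma sq_eq_one_of_abs_rpow_eq_one {p x : ℝ} (hp : p ≠ 0) (h : |x| ^ p = 1) : x ^ 2 = 1 := by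
  have hx : |x| = 1 := (Real.rpow_left_inj (abs_nonneg x) zero_le_one hp).1 (by simpa using h)
  rw [← sq_abs, hx, one_pow]

/-- For `p ≠ 2`, a matrix preserving the `p`-th-power weight sum is a signed permutation. -/
lemma signed_permutation_of_preserves_rpow {p : ℝ} (hp : 0 < p) (hp2 : p ≠ 2)
    {M : Matrix (Fin 2) (Fin 2) ℝ}
    (hM : ∀ v : Fin 2 → ℝ,
      |M.mulVec v 0| ^ p + |M.mulVec v 1| ^ p = |v 0| ^ p + |v 1| ^ p) :
    (M 0 1 = 0 ∧ M 1 0 = 0 ∧ M 0 0 ^ 2 = 1 ∧ M 1 1 ^ 2 = 1) ∨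
      (M 0 0 = 0 ∧ M 1 1 = 0 ∧ M 0 1 ^ 2 = 1 ∧ M 1 0 ^ 2 = 1) := by
  have hz := Real.zero_rpow hp.ne'
  have h₁ := hM ![1, 0]
  have h₂ := hM ![0, 1]
  have h₃ := hM ![1, 1]
  have h₄ := hM ![1, -1]
  simp only [Matrix.mulVec, dotProduct, Fin.sum_univ_two, Matrix.cons_val_zero,
    Matrix.cons_val_one, mul_one, mul_zero, add_zero, zero_add, mul_neg, abs_neg, abs_one,
    abs_zero, Real.one_rpow, hz, ← sub_eq_add_neg] at h₁ h₂ h₃ h₄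
  obtain ⟨hab, hcd⟩ := mul_eq_zero_of_clarkson_eq (a := M 0 0) (b := M 0 1) (c := M 1 0)
    (d := M 1 1) hp hp2 (by linarith)
  rcases mul_eq_zero.1 hab with ha | hb
  · rw [ha, abs_zero, hz, zero_add] at h₁
    have hc := sq_eq_one_of_abs_rpow_eq_one hp.ne' h₁
    have hd : M 1 1 = 0 := (mul_eq_zero.1 hcd).resolve_left fun h => by simp [h] at hc
    rw [hd, abs_zero, hz, add_zero] at h₂
    exact .inr ⟨ha, hd, sq_eq_one_of_abs_rpow_eq_one hp.ne' h₂, hc⟩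
  · rw [hb, abs_zero, hz, zero_add] at h₂
    have hd := sq_eq_one_of_abs_rpow_eq_one hp.ne' h₂
    have hc : M 1 0 = 0 := (mul_eq_zero.1 hcd).resolve_right fun h => by simp [h] at hd
    rw [hc, abs_zero, hz, add_zero] at h₁
    exact .inl ⟨hb, hc, sq_eq_one_of_abs_rpow_eq_one hp.ne' h₁, hd⟩

lemma pow_four_eq_one_of_preserves_rpow {p : ℝ} (hp : 0 < p) (hp2 : p ≠ 2)
    {M : Matrix (Fin 2) (Fin 2) ℝ}
    (hM : ∀ v : Fin 2 → ℝ,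
      |M.mulVec v 0| ^ p + |M.mulVec v 1| ^ p = |v 0| ^ p + |v 1| ^ p) :
    M * M * (M * M) = 1 := by
  ext i j
  rcases signed_permutation_of_preserves_rpow hp hp2 hM with
    ⟨hx, hy, hu, hv⟩ | ⟨hx, hy, hu, hv⟩ <;>
  fin_cases i <;> fin_cases j <;>
  simp [Matrix.mul_apply, Fin.sum_univ_two, hx, hy] <;> grind

/-- For `p ≥ 1`, `p ≠ 2`, any continuous one-parameter group of `2 × 2` real
matrices preserving the `p`-th-power weight sum is trivial. -/
theorem no_nontrivial_one_parameter_group (p : ℝ) (hp : 1 ≤ p) (hp2 : p ≠ 2)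
    (U : ℝ → Matrix (Fin 2) (Fin 2) ℝ)
    (hcont : Continuous U) (h0 : U 0 = 1)
    (hgrp : ∀ s t : ℝ, U (s + t) = U s * U t)
    (hiso : ∀ (t : ℝ) (v : Fin 2 → ℝ),
      |(U t).mulVec v 0| ^ p + |(U t).mulVec v 1| ^ p =
        |v 0| ^ p + |v 1| ^ p) :
    ∀ t : ℝ, U t = 1 := by
  intro t
  rw [show t = t / 4 + t / 4 + (t / 4 + t / 4) by ring, hgrp, hgrp]
  exact pow_four_eq_one_of_preserves_rpow (by linarith) hp2 (hiso (t / 4))
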